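/- arXiv:1608.05157 — 2 statements merged into one kernel-verified Lean document; each statement's English description precedes it below -/
import Mathlib

section
/- Let G be a finite abelian group and let H be a subgroup of G such that exp(G) = exp(H) · exp(G/H). Then η(G) ≤ (η(H) − 1) · exp(G/H) + η(G/H). -/
/-- The zero-sum invariant `s_L(G)`: the smallest positive integer `ℓ` such that every
sequence (multiset) over `G` of length at least `ℓ` contains a nonempty zero-sum
subsequence whose length lies in `L`. -/
noncomputable def zsInv (G : Type*) [AddCommGroup G] (L : Set ℕ) : ℕ :=
  sInf {ℓ : ℕ | 0 < ℓ ∧ ∀ S : Multiset G, ℓ ≤ Multiset.card S →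
    ∃ T : Multiset G, T ≤ S ∧ T ≠ 0 ∧ T.sum = 0 ∧ Multiset.card T ∈ L}

/-- The Davenport constant `D(G)`. -/
noncomputable def davenport (G : Type*) [AddCommGroup G] : ℕ := zsInv G {t | 0 < t}

/-- The η-invariant `η(G) = s_{[1, exp(G)]}(G)`. -/
noncomputable def etaInv (G : Type*) [AddCommGroup G] : ℕ :=
  zsInv G {t | 0 < t ∧ t ≤ AddMonoid.exponent G}

/-- The Erdős–Ginzburg–Ziv constant `s(G) = s_{{exp(G)}}(G)`. -/
noncomputable def egzConst (G : Type*) [AddCommGroup G] : ℕ :=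
  zsInv G {AddMonoid.exponent G}

/-- `η_i(G) = s_{[i, exp(G)]}(G)`. -/
noncomputable def etaI (G : Type*) [AddCommGroup G] (i : ℕ) : ℕ :=
  zsInv G {t | i ≤ t ∧ t ≤ AddMonoid.exponent G}

/-- `ζ_i(G) = s_{[i-n,0] + nℕ⁺}(G)` where `n = exp(G)`: the invariant for zero-sum
subsequences whose length is congruent mod `n` to some residue `r` with `i ≤ r ≤ n`. -/
noncomputable def zetaI (G : Type*) [AddCommGroup G] (i : ℕ) : ℕ :=
  zsInv G {t | 0 < t ∧ ∃ r : ℕ, i ≤ r ∧ r ≤ AddMonoid.exponent G ∧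
    t % AddMonoid.exponent G = r % AddMonoid.exponent G}

theorem Multiset.exists_le_map_eq_of_le_map {α β : Type*} {f : α → β} {s : Multiset α}
    {t : Multiset β} (h : t ≤ s.map f) : ∃ u ≤ s, u.map f = t := by
  induction s using Quotient.inductionOn with | _ l =>
  induction t using Quotient.inductionOn with | _ l' =>
  obtain ⟨l₁, hp, hs⟩ := Multiset.coe_le.1 h
  obtain ⟨l₂, hl, rfl⟩ := List.sublist_map_iff.1 hs
  exact ⟨(l₂ : Multiset α), Multiset.coe_le.2 hl.subperm, Multiset.coe_eq_coe.2 hp⟩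

/-- In a finite abelian group, `η(K)` is positive and has its defining property. -/
theorem etaInv_spec (K : Type*) [AddCommGroup K] [Finite K] :
    0 < etaInv K ∧ ∀ S : Multiset K, etaInv K ≤ Multiset.card S →
      ∃ T : Multiset K, T ≤ S ∧ T ≠ 0 ∧ T.sum = 0 ∧ 0 < Multiset.card T ∧
        Multiset.card T ≤ AddMonoid.exponent K := by
  classical
  have := Fintype.ofFinite K
  have hpos : 0 < AddMonoid.exponent K :=
    Nat.pos_of_ne_zero AddMonoid.exponent_ne_zero_of_finite
  refine Nat.sInf_mem (s := {ℓ : ℕ | 0 < ℓ ∧ ∀ S : Multiset K, ℓ ≤ Multiset.card S →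
    ∃ T : Multiset K, T ≤ S ∧ T ≠ 0 ∧ T.sum = 0 ∧
      Multiset.card T ∈ {t | 0 < t ∧ t ≤ AddMonoid.exponent K}})
    ⟨Fintype.card K * AddMonoid.exponent K, Nat.mul_pos Fintype.card_pos hpos, fun S hS => ?_⟩
  obtain ⟨x, hx⟩ : ∃ x, AddMonoid.exponent K ≤ S.count x := by
    by_contra! h
    have hlt : ∑ x : K, S.count x < ∑ _x : K, AddMonoid.exponent K :=
      Finset.sum_lt_sum_of_nonempty Finset.univ_nonempty fun x _ => h x
    rw [Multiset.sum_count_eq_card fun a _ => Finset.mem_univ a] at hlt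
    simp only [Finset.sum_const, Finset.card_univ, smul_eq_mul] at hlt
    lia
  refine ⟨Multiset.replicate (AddMonoid.exponent K) x, Multiset.le_count_iff_replicate_le.1 hx,
    ?_, ?_, ?_⟩
  · rw [← Multiset.card_pos, Multiset.card_replicate]
    exact hpos
  · rw [Multiset.sum_replicate, AddMonoid.exponent_nsmul_eq_zero]
  · simpa using hpos

/-- A long sequence over `G` contains many disjoint short nonempty blocks with sum in `H`. -/
theorem exists_disjoint_blocks {G : Type*} [AddCommGroup G] [Finite G] (H : AddSubgroup G)
    (k : ℕ) (S : Multiset G)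
    (hS : k * AddMonoid.exponent (G ⧸ H) + etaInv (G ⧸ H) ≤ Multiset.card S) :
    ∃ B : Multiset {T : Multiset G // T.sum ∈ H ∧ 0 < Multiset.card T ∧
        Multiset.card T ≤ AddMonoid.exponent (G ⧸ H)},
      Multiset.card B = k + 1 ∧ (B.map Subtype.val).sum ≤ S := by
  classical
  induction k generalizing S with
  | zero =>
    obtain ⟨U, hU, -, hsum, hpos, hle⟩ :=
      (etaInv_spec (G ⧸ H)).2 (S.map (QuotientAddGroup.mk' H)) (by simpa using hS)
    obtain ⟨T, hT, rfl⟩ := Multiset.exists_le_map_eq_of_le_map hU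
    rw [← map_multiset_sum, QuotientAddGroup.mk'_apply, QuotientAddGroup.eq_zero_iff] at hsum
    rw [Multiset.card_map] at hpos hle
    exact ⟨{⟨T, hsum, hpos, hle⟩}, by simp, by simpa using hT⟩
  | succ k ih =>
    obtain ⟨U, hU, -, hsum, hpos, hle⟩ :=
      (etaInv_spec (G ⧸ H)).2 (S.map (QuotientAddGroup.mk' H))
        (by rw [Multiset.card_map]; lia)
    obtain ⟨T, hT, rfl⟩ := Multiset.exists_le_map_eq_of_le_map hU
    rw [← map_multiset_sum, QuotientAddGroup.mk'_apply, QuotientAddGroup.eq_zero_iff] at hsum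
    rw [Multiset.card_map] at hpos hle
    obtain ⟨B, hB, hBS⟩ := ih (S - T) (by
      rw [Multiset.card_sub hT]
      rw [add_mul, one_mul] at hS
      lia)
    refine ⟨⟨T, hsum, hpos, hle⟩ ::ₘ B, by simp [hB], ?_⟩
    rw [Multiset.map_cons, Multiset.sum_cons]
    calc T + (B.map Subtype.val).sum ≤ T + (S - T) := by gcongr
      _ = S := add_tsub_cancel_of_le hT

/-- Let `G` be a finite abelian group and `H` a subgroup with
`exp(G) = exp(H) · exp(G/H)`. Then `η(G) ≤ (η(H) − 1)·exp(G/H) + η(G/H)`. -/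
theorem stmt17 (G : Type*) [AddCommGroup G] [Finite G] (H : AddSubgroup G)
    (hexp : AddMonoid.exponent G =
      AddMonoid.exponent H * AddMonoid.exponent (G ⧸ H)) :
    etaInv G ≤ (etaInv H - 1) * AddMonoid.exponent (G ⧸ H) + etaInv (G ⧸ H) := by
  have hη := etaInv_spec H
  refine Nat.sInf_le ⟨Nat.add_pos_right _ (etaInv_spec (G ⧸ H)).1, fun S hS => ?_⟩
  obtain ⟨B, hB, hBS⟩ := exists_disjoint_blocks H _ S hS
  let blockSum (T : {T : Multiset G // T.sum ∈ H ∧ 0 < Multiset.card T ∧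
      Multiset.card T ≤ AddMonoid.exponent (G ⧸ H)}) : H := ⟨T.1.sum, T.2.1⟩
  obtain ⟨U, hU, -, hsum, hpos, hle⟩ :=
    hη.2 (B.map blockSum) (by rw [Multiset.card_map]; lia)
  obtain ⟨C, hC, rfl⟩ := Multiset.exists_le_map_eq_of_le_map hU
  rw [Multiset.card_map] at hpos hle
  have hcard : Multiset.card (C.map Subtype.val).sum =
      (C.map fun T => Multiset.card T.1).sum := by
    refine (map_multiset_sum Multiset.cardHom (C.map Subtype.val)).trans ?_
    rw [Multiset.map_map]
    rfl
  have hcard_pos : 0 < Multiset.card (C.map Subtype.val).sum := by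
    obtain ⟨T, hT⟩ := Multiset.card_pos_iff_exists_mem.1 hpos
    rw [hcard]
    exact T.2.2.1.trans_le (Multiset.le_sum_of_mem (Multiset.mem_map_of_mem
      (fun T => Multiset.card T.1) hT))
  refine ⟨(C.map Subtype.val).sum, ?_, Multiset.card_pos.1 hcard_pos, ?_, hcard_pos, ?_⟩
  · refine le_trans ?_ hBS
    obtain ⟨D, rfl⟩ := Multiset.le_iff_exists_add.1 hC
    simp
  · have h := congrArg H.subtype hsum
    rw [map_multiset_sum, Multiset.map_map, map_zero] at h
    refine (map_multiset_sum Multiset.sumAddMonoidHom (C.map Subtype.val)).trans ?_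
    rw [Multiset.map_map]
    exact h
  · rw [hcard, hexp]
    calc (C.map fun T => Multiset.card T.1).sum
        ≤ Multiset.card (C.map fun T => Multiset.card T.1) • AddMonoid.exponent (G ⧸ H) := by
          refine Multiset.sum_le_card_nsmul _ _ fun x hx => ?_
          obtain ⟨T, -, rfl⟩ := Multiset.mem_map.1 hx
          exact T.2.2.2
      _ ≤ AddMonoid.exponent H * AddMonoid.exponent (G ⧸ H) := by
          rw [Multiset.card_map, smul_eq_mul]
          gcongr
end

section
/- Let p be a prime and write a finite abelian p-group G with exp(G) = n and D(G) ≤ 2n − 1 as G = C_n ⊕ H. For a positive integer a, let G' = C_{a·n} ⊕ H. If p > 2·r(H) and ⌈2·D(H)/exp(H)⌉ is either even or at most 3, then 2·D(G') − 1 = η(G') + exp(G') − 1. -/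
/-- A multiset none of whose nonempty submultisets sums to zero. -/
def IsZeroSumFree {K : Type*} [AddCommGroup K] (S : Multiset K) : Prop :=
  ∀ T ≤ S, T.sum = 0 → T = 0

/-- `K` is generated by finitely many elements annihilated by powers `p ^ q i` of `p`,
with `d = ∑ i, (p ^ q i - 1)`. -/
def HasPrimePowerGenerators (p : ℕ) (K : Type*) [AddCommGroup K] (d : ℕ) : Prop :=
  ∃ (ι : Type) (_ : Fintype ι) (e : ι → K) (q : ι → ℕ), (∀ i, p ^ q i • e i = 0) ∧
    AddSubgroup.closure (Set.range e) = ⊤ ∧ ∑ i, (p ^ q i - 1) = d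

/-! ### Olson's theorem -/

theorem add_pow_eq_zero_of_pow_eq_zero {R : Type*} [CommSemiring R] {x y : R} {a b : ℕ}
    (hx : x ^ (a + 1) = 0) (hy : y ^ (b + 1) = 0) : (x + y) ^ (a + b + 1) = 0 := by
  rw [add_pow]
  refine Finset.sum_eq_zero fun k hk => ?_
  rw [Finset.mem_range] at hk
  rcases le_or_gt (a + 1) k with h | h
  · rw [pow_eq_zero_of_le h hx, zero_mul, zero_mul]
  · rw [pow_eq_zero_of_le (show b + 1 ≤ a + b + 1 - k by omega) hy, mul_zero, zero_mul]

theorem sum_pow_eq_zero_of_pow_eq_zero {R ι : Type*} [CommSemiring R] (s : Finset ι) (x : ι → R)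
    (a : ι → ℕ) (h : ∀ i, x i ^ (a i + 1) = 0) : (∑ i ∈ s, x i) ^ (∑ i ∈ s, a i + 1) = 0 := by
  classical
  induction s using Finset.induction_on with
  | empty => simp
  | insert i s hi ih =>
    rw [Finset.sum_insert hi, Finset.sum_insert hi]
    exact add_pow_eq_zero_of_pow_eq_zero (h i) ih

section GroupRing

variable {K : Type*} [AddCommGroup K]

open AddMonoidAlgebra in
theorem prod_one_sub_single_sub_one_mem_span (F : Type*) [CommRing F] (S : Multiset K) :
    (S.map fun g => (1 - single g 1 : AddMonoidAlgebra F K)).prod - 1 ∈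
      Submodule.span F {x : AddMonoidAlgebra F K | ∃ T ≤ S, T ≠ 0 ∧ x = single T.sum 1} := by
  induction S using Multiset.induction_on with
  | empty => simp
  | cons g S ih =>
    set V := Submodule.span F
      {x : AddMonoidAlgebra F K | ∃ T ≤ g ::ₘ S, T ≠ 0 ∧ x = single T.sum 1}
    set f := (S.map fun g => (1 - single g 1 : AddMonoidAlgebra F K)).prod
    have h1 : f - 1 ∈ V := by
      refine Submodule.span_mono ?_ ih
      rintro x ⟨T, hT, hT0, rfl⟩
      exact ⟨T, hT.trans (Multiset.le_cons_self _ _), hT0, rfl⟩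
    have h2 : single g 1 ∈ V := by
      refine Submodule.subset_span ⟨{g}, ?_, by simp, by simp⟩
      simp
    have h3 : ∀ y ∈ Submodule.span F
        {x : AddMonoidAlgebra F K | ∃ T ≤ S, T ≠ 0 ∧ x = single T.sum 1},
        single g 1 * y ∈ V := by
      intro y hy
      induction hy using Submodule.span_induction with
      | mem x hx =>
        obtain ⟨T, hT, hT0, rfl⟩ := hx
        refine Submodule.subset_span ⟨g ::ₘ T, Multiset.cons_le_cons _ hT, by simp, ?_⟩
        rw [single_mul_single, one_mul, Multiset.sum_cons]
      | zero => simp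
      | add x y _ _ hx hy => rw [mul_add]; exact V.add_mem hx hy
      | smul c x _ hx => rw [mul_smul_comm]; exact V.smul_mem c hx
    have : ((g ::ₘ S).map fun g => (1 - single g 1 : AddMonoidAlgebra F K)).prod - 1
        = (f - 1) - single g 1 - single g 1 * (f - 1) := by
      rw [Multiset.map_cons, Multiset.prod_cons]
      ring
    rw [this]
    exact V.sub_mem (V.sub_mem h1 h2) (h3 _ ih)

open AddMonoidAlgebra in
theorem not_isZeroSumFree_of_prod_eq_zero (F : Type*) [CommRing F] [Nontrivial F] (S : Multiset K)
    (h : (S.map fun g => (1 - single g 1 : AddMonoidAlgebra F K)).prod = 0) :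
    ¬ IsZeroSumFree S := by
  intro hS
  have hmem := prod_one_sub_single_sub_one_mem_span F S
  rw [h, zero_sub] at hmem
  have hcoeff : ∀ y ∈ Submodule.span F
      {x : AddMonoidAlgebra F K | ∃ T ≤ S, T ≠ 0 ∧ x = single T.sum 1}, y.coeff 0 = 0 := by
    intro y hy
    induction hy using Submodule.span_induction with
    | mem x hx =>
      obtain ⟨T, hT, hT0, rfl⟩ := hx
      have : T.sum ≠ 0 := fun h0 => hT0 (hS T hT h0)
      simp [this]
    | zero => simp
    | add x y _ _ hx hy => simp [hx, hy]
    | smul c x _ hx => simp [hx]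
  have := hcoeff _ hmem
  simp [one_def] at this

open AddMonoidAlgebra in
/-- **Olson's theorem**, upper bound. -/
theorem HasPrimePowerGenerators.not_isZeroSumFree {p d : ℕ} (hp : p.Prime)
    (hK : HasPrimePowerGenerators p K d) {S : Multiset K} (hS : d + 1 ≤ Multiset.card S) :
    ¬ IsZeroSumFree S := by
  obtain ⟨ι, _, e, q, he, hgen, rfl⟩ := hK
  have : Fact p.Prime := ⟨hp⟩
  let A := AddMonoidAlgebra (ZMod p) K
  have : CharP A p := charP_of_injective_algebraMap (algebraMap (ZMod p) A).injective p
  let I : Ideal A := ∑ i, Ideal.span {1 - single (e i) 1}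
  have hI : I ^ (∑ i, (p ^ q i - 1) + 1) = 0 := by
    refine sum_pow_eq_zero_of_pow_eq_zero _ _ _ fun i => ?_
    rw [Nat.sub_add_cancel (Nat.one_le_pow _ _ hp.pos), Ideal.span_singleton_pow,
      sub_pow_char_pow, single_pow, he, one_pow, one_pow, one_def, sub_self]
    simp
  have hmem : ∀ g : K, (1 - single g 1 : A) ∈ I := by
    intro g
    have hg : g ∈ AddSubgroup.closure (Set.range e) := hgen ▸ AddSubgroup.mem_top g
    induction hg using AddSubgroup.closure_induction with
    | mem x hx =>
      obtain ⟨i, rfl⟩ := hx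
      have : Ideal.span {1 - single (e i) 1} ≤ I := by
        simp only [I, Ideal.sum_eq_sup]
        exact Finset.le_sup (f := fun i => Ideal.span {(1 - single (e i) 1 : A)})
          (Finset.mem_univ i)
      exact this (Ideal.mem_span_singleton_self _)
    | zero => rw [← one_def, sub_self]; exact I.zero_mem
    | add x y _ _ hx hy =>
      have : (1 - single (x + y) 1 : A) = (1 - single x 1) + single x 1 * (1 - single y 1) := by
        rw [mul_sub, single_mul_single, one_mul, mul_one]; ring
      rw [this]
      exact I.add_mem hx (I.mul_mem_left _ hy)
    | neg x _ hx =>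
      have : (1 - single (-x) 1 : A) = -single (-x) 1 * (1 - single x 1) := by
        rw [mul_sub, neg_mul, neg_mul, single_mul_single, one_mul, mul_one, neg_add_cancel, ← one_def]
        ring
      rw [this]
      exact I.mul_mem_left _ hx
  refine not_isZeroSumFree_of_prod_eq_zero (ZMod p) S ?_
  have hprod : ∀ S : Multiset K, (S.map fun g => (1 - single g 1 : A)).prod ∈
      I ^ (Multiset.card S) := by
    intro S
    induction S using Multiset.induction_on with
    | empty => simp
    | cons g S ih =>
      rw [Multiset.map_cons, Multiset.prod_cons, Multiset.card_cons, pow_succ']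
      exact Ideal.mul_mem_mul (hmem g) ih
  have := Ideal.pow_le_pow_right hS (hprod S)
  rwa [hI] at this

end GroupRing

theorem HasPrimePowerGenerators.zmod_prod {p k d : ℕ} {K : Type*} [AddCommGroup K]
    (hK : HasPrimePowerGenerators p K d) :
    HasPrimePowerGenerators p (ZMod (p ^ k) × K) (p ^ k - 1 + d) := by
  obtain ⟨ι, _, e, q, he, hgen, rfl⟩ := hK
  refine ⟨Option ι, inferInstance, fun o => o.elim (1, 0) fun i => (0, e i),
    fun o => o.elim k q, ?_, ?_, by simp [Fintype.sum_option]⟩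
  · rintro (_ | i)
    · simp [Prod.ext_iff]
    · simp [he]
  · set C := AddSubgroup.closure
      (Set.range fun o : Option ι => o.elim ((1, 0) : ZMod (p ^ k) × K) fun i => (0, e i))
    have h1 : ((1, 0) : ZMod (p ^ k) × K) ∈ C := AddSubgroup.subset_closure ⟨none, rfl⟩
    have h2 : ∀ h : K, ((0, h) : ZMod (p ^ k) × K) ∈ C := by
      have : AddSubgroup.closure (Set.range e) ≤ C.comap (AddMonoidHom.inr (ZMod (p ^ k)) K) := by
        rw [AddSubgroup.closure_le]
        rintro _ ⟨i, rfl⟩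
        exact AddSubgroup.subset_closure ⟨some i, rfl⟩
      intro h
      exact this (hgen ▸ AddSubgroup.mem_top h)
    refine eq_top_iff.2 fun x _ => ?_
    obtain ⟨u, h⟩ := x
    obtain ⟨z, rfl⟩ := ZMod.intCast_surjective u
    have : (((z : ZMod (p ^ k)), h) : ZMod (p ^ k) × K) = z • (1, 0) + (0, h) := by simp
    rw [this]
    exact C.add_mem (C.zsmul_mem h1 z) (h2 h)

/-! ### Submultisets -/

theorem Multiset.exists_le_eq_map_of_le_map {α β : Type*} (f : α → β) (S : Multiset α)
    {U : Multiset β} (hU : U ≤ S.map f) : ∃ T ≤ S, U = T.map f := by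
  induction S using Multiset.induction_on generalizing U with
  | empty => exact ⟨0, le_rfl, by simpa using hU⟩
  | cons g S ih =>
    rw [Multiset.map_cons] at hU
    by_cases hg : f g ∈ U
    · obtain ⟨U', rfl⟩ := Multiset.exists_cons_of_mem hg
      obtain ⟨T, hT, rfl⟩ := ih ((Multiset.cons_le_cons_iff _).1 hU)
      exact ⟨g ::ₘ T, Multiset.cons_le_cons _ hT, by simp⟩
    · obtain ⟨T, hT, rfl⟩ := ih ((Multiset.le_cons_of_notMem hg).1 hU)
      exact ⟨T, hT.trans (Multiset.le_cons_self _ _), rfl⟩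

theorem Multiset.exists_add_of_le_add {α : Type*} {A B U : Multiset α} (hU : U ≤ A + B) :
    ∃ V ≤ A, ∃ W ≤ B, U = V + W := by
  classical
  refine ⟨U ∩ A, Multiset.inter_le_right, U - A, ?_, ?_⟩
  · rw [Multiset.sub_le_iff_le_add, add_comm]; exact hU
  · rw [add_comm, Multiset.sub_add_inter]

theorem Multiset.exists_le_card_eq_of_le_card {α : Type*} {S : Multiset α} {k : ℕ}
    (h : k ≤ Multiset.card S) : ∃ T ≤ S, Multiset.card T = k := by
  induction S using Quotient.inductionOn with
  | h l => exact ⟨(l.take k : List α), (List.take_sublist k l).subperm, by simpa using h⟩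

theorem Multiset.sum_le_sum_of_le {α : Type*} {M N : Multiset (Multiset α)} (h : M ≤ N) :
    M.sum ≤ N.sum := by
  obtain ⟨R, rfl⟩ := Multiset.le_iff_exists_add.1 h
  rw [Multiset.sum_add]
  exact Multiset.le_add_right _ _

theorem Multiset.card_sum_le_of_forall_le {α : Type*} {M : Multiset (Multiset α)} {n : ℕ}
    (h : ∀ T ∈ M, Multiset.card T ≤ n) : Multiset.card M.sum ≤ Multiset.card M * n := by
  induction M using Multiset.induction_on with
  | empty => simp
  | cons T M ih =>
    rw [Multiset.sum_cons, Multiset.card_add, Multiset.card_cons]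
    have := h T (Multiset.mem_cons_self _ _)
    have := ih fun T hT => h T (Multiset.mem_cons_of_mem hT)
    lia

/-! ### The invariant `zsInv` -/

section ZsInv

variable {K : Type*} [AddCommGroup K] {L : Set ℕ}

theorem zsInv_eq_of_card_add_one {ℓ : ℕ} (hℓ : ∀ S : Multiset K, ℓ ≤ Multiset.card S →
      ∃ T ≤ S, T ≠ 0 ∧ T.sum = 0 ∧ Multiset.card T ∈ L)
    {S : Multiset K} (hS : Multiset.card S + 1 = ℓ)
    (hfree : ∀ T ≤ S, T.sum = 0 → Multiset.card T ∈ L → T = 0) : zsInv K L = ℓ := by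
  refine le_antisymm (Nat.sInf_le ⟨by omega, hℓ⟩) (le_csInf ⟨ℓ, by omega, hℓ⟩ ?_)
  rintro m ⟨-, hm⟩
  by_contra! hlt
  obtain ⟨T, hT, hT0, hsum, hcard⟩ := hm S (by omega)
  exact hT0 (hfree T hT hsum hcard)

theorem exists_zeroSum_of_not_isZeroSumFree {S : Multiset K} (h : ¬ IsZeroSumFree S) :
    ∃ T ≤ S, T ≠ 0 ∧ T.sum = 0 := by
  unfold IsZeroSumFree at h
  push Not at h
  obtain ⟨T, hT, hs, h0⟩ := h
  exact ⟨T, hT, h0, hs⟩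

theorem davenport_eq_of_isZeroSumFree {d : ℕ}
    (h : ∀ S : Multiset K, d + 1 ≤ Multiset.card S → ¬ IsZeroSumFree S)
    {S : Multiset K} (hS : Multiset.card S = d) (hfree : IsZeroSumFree S) :
    davenport K = d + 1 := by
  refine zsInv_eq_of_card_add_one (fun S hS => ?_) (congrArg (· + 1) hS)
    fun T hT hs _ => hfree T hT hs
  obtain ⟨T, hT, hT0, hs⟩ := exists_zeroSum_of_not_isZeroSumFree (h S hS)
  exact ⟨T, hT, hT0, hs, Multiset.card_pos.2 hT0⟩

end ZsInv

/-! ### Extremal sequences -/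

section Extremal

variable {H : Type*} [AddCommGroup H]

theorem isZeroSumFree_sum_replicate_single {r : ℕ} {m : Fin r → ℕ} (hm : ∀ i, 1 < m i) :
    IsZeroSumFree (∑ i, Multiset.replicate (m i - 1)
      (Pi.single i 1 : (i : Fin r) → ZMod (m i))) := by
  intro T hT hsum
  have hfact : ∀ i, Fact (1 < m i) := fun i => ⟨hm i⟩
  set e : Fin r → ((i : Fin r) → ZMod (m i)) := fun i => Pi.single i 1
  have he : ∀ i j, e i j = if i = j then 1 else 0 := by
    intro i j
    by_cases h : i = j
    · subst h; simp [e]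
    · simp [e, h]
  have hinj : Function.Injective e := by
    intro i j hij
    by_contra hne
    have := congrFun hij i
    rw [he, he, if_pos rfl, if_neg (Ne.symm hne)] at this
    exact one_ne_zero this
  have hmem : ∀ x ∈ T, ∃ i, x = e i := by
    intro x hx
    obtain ⟨i, -, hi⟩ := Multiset.mem_sum.1 (Multiset.mem_of_le hT hx)
    exact ⟨i, Multiset.eq_of_mem_replicate hi⟩
  have hcount : ∀ j, T.count (e j) ≤ m j - 1 := by
    intro j
    refine (Multiset.count_le_of_le _ hT).trans ?_
    rw [Multiset.count_sum', Finset.sum_eq_single j]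
    · simp [e]
    · intro i _ hij
      exact Multiset.count_eq_zero.2 fun h => hij (hinj (Multiset.eq_of_mem_replicate h)).symm
    · simp
  have hcoord : ∀ (j : Fin r) (T : Multiset ((i : Fin r) → ZMod (m i))), (∀ x ∈ T, ∃ i, x = e i) →
      T.sum j = (T.count (e j) : ZMod (m j)) := by
    intro j T hT
    induction T using Multiset.induction_on with
    | empty => simp
    | cons x T ih =>
      obtain ⟨i, rfl⟩ := hT x (Multiset.mem_cons_self _ _)
      rw [Multiset.sum_cons, Pi.add_apply, ih fun x hx => hT x (Multiset.mem_cons_of_mem hx), he,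
        Multiset.count_cons]
      by_cases h : i = j
      · subst h; simp [add_comm]
      · have hne : e j ≠ e i := fun h' => h (hinj h').symm
        simp [h, hne]
  refine Multiset.eq_zero_of_forall_notMem fun x hx => ?_
  obtain ⟨j, rfl⟩ := hmem x hx
  have h0 := hcoord j T hmem
  rw [hsum, Pi.zero_apply] at h0
  have hdvd := (ZMod.natCast_eq_zero_iff _ _).1 h0.symm
  have := Nat.le_of_dvd (Multiset.count_pos.2 hx) hdvd
  have := hcount j
  have := hm j
  omega

theorem IsZeroSumFree.map_addEquiv {K : Type*} [AddCommGroup K] (φ : K ≃+ H) {S : Multiset K}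
    (hS : IsZeroSumFree S) : IsZeroSumFree (S.map φ) := by
  intro U hU hsum
  obtain ⟨T, hT, rfl⟩ := Multiset.exists_le_eq_map_of_le_map _ _ hU
  rw [← map_multiset_sum, EmbeddingLike.map_eq_zero_iff] at hsum
  rw [hS T hT hsum, Multiset.map_zero]

theorem sum_map_prodMk (N : ℕ) (u : ZMod N) (T : Multiset H) :
    (T.map fun h => (u, h)).sum = ((Multiset.card T : ZMod N) * u, T.sum) := by
  induction T using Multiset.induction_on with
  | empty => simp [Prod.ext_iff]
  | cons h T ih => simp [ih]; ring

theorem IsZeroSumFree.replicate_add_map {N : ℕ} (hN : 0 < N) {T : Multiset H}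
    (hT : IsZeroSumFree T) :
    IsZeroSumFree (Multiset.replicate (N - 1) ((1, 0) : ZMod N × H) +
      T.map fun h => ((0 : ZMod N), h)) := by
  intro U hU hsum
  obtain ⟨V, hV, W, hW, rfl⟩ := Multiset.exists_add_of_le_add hU
  obtain ⟨j, hj, rfl⟩ := Multiset.le_replicate_iff.1 hV
  obtain ⟨A, hA, rfl⟩ := Multiset.exists_le_eq_map_of_le_map _ _ hW
  rw [Multiset.sum_add, sum_map_prodMk, Multiset.sum_replicate, Prod.ext_iff] at hsum
  simp only [Prod.smul_mk, nsmul_eq_mul, mul_one, smul_zero, mul_zero, Prod.mk_add_mk, add_zero,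
    zero_add, Prod.fst_zero, Prod.snd_zero] at hsum
  have hj0 : j = 0 := Nat.eq_zero_of_dvd_of_lt ((ZMod.natCast_eq_zero_iff _ _).1 hsum.1) (by omega)
  simp [hj0, hT A hA hsum.2]

theorem IsZeroSumFree.eq_zero_of_card_le {N : ℕ} (hN : 0 < N) {T : Multiset H}
    (hT : IsZeroSumFree T) {U : Multiset (ZMod N × H)}
    (hU : U ≤ Multiset.replicate (N - 1) (1, 0) + ((T.map fun h => (0, h)) +
      T.map fun h => (1, h))) (hsum : U.sum = 0) (hcard : Multiset.card U ≤ N) : U = 0 := by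
  obtain ⟨V, hV, W, hW, rfl⟩ := Multiset.exists_add_of_le_add hU
  obtain ⟨j, hj, rfl⟩ := Multiset.le_replicate_iff.1 hV
  obtain ⟨W₁, hW₁, W₂, hW₂, rfl⟩ := Multiset.exists_add_of_le_add hW
  obtain ⟨A, hA, rfl⟩ := Multiset.exists_le_eq_map_of_le_map _ _ hW₁
  obtain ⟨B, hB, rfl⟩ := Multiset.exists_le_eq_map_of_le_map _ _ hW₂
  rw [Multiset.sum_add, Multiset.sum_add, sum_map_prodMk, sum_map_prodMk, Multiset.sum_replicate,
    Prod.ext_iff] at hsum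
  simp only [Prod.smul_mk, nsmul_eq_mul, mul_one, smul_zero, mul_zero, Prod.mk_add_mk,
    zero_add, Prod.fst_zero, Prod.snd_zero] at hsum
  simp only [Multiset.card_add, Multiset.card_map, Multiset.card_replicate] at hcard
  obtain ⟨h1, h2⟩ := hsum
  rw [← Nat.cast_add, ZMod.natCast_eq_zero_iff] at h1
  rcases Nat.eq_zero_or_pos (j + Multiset.card B) with h | h
  · have hB0 : B = 0 := Multiset.card_eq_zero.1 (by omega)
    have hj0 : j = 0 := by omega
    subst hB0 hj0
    simp [hT A hA (by simpa using h2)]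
  · have hle := Nat.le_of_dvd h h1
    have hA0 : A = 0 := Multiset.card_eq_zero.1 (by omega)
    subst hA0
    have hB0 : B = 0 := hT B hB (by simpa using h2)
    subst hB0
    simp at hle
    omega

end Extremal

/-! ### Short zero-sum submultisets over `p`-groups -/

theorem exists_short_zeroSum {p k d : ℕ} (hp : p.Prime) {H : Type*} [AddCommGroup H]
    (hH : HasPrimePowerGenerators p H d) (hd : d + 1 ≤ p ^ k) (S : Multiset (ZMod (p ^ k) × H))
    (hS : p ^ k + 2 * d ≤ Multiset.card S) :
    ∃ T ≤ S, T ≠ 0 ∧ T.sum = 0 ∧ Multiset.card T ≤ p ^ k := by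
  classical
  obtain ⟨S, hS', hScard⟩ := Multiset.exists_le_card_eq_of_le_card hS
  suffices h : ∃ T ≤ S, T ≠ 0 ∧ T.sum = 0 ∧ Multiset.card T ≤ p ^ k by
    obtain ⟨T, hT, h⟩ := h
    exact ⟨T, hT.trans hS', h⟩
  by_contra! hlong
  have hG := hH.zmod_prod (k := k)
  have hG' := hG.zmod_prod (k := k)
  generalize p ^ k = n at *
  have hnot : ¬ IsZeroSumFree ((S.map fun g => ((1 : ZMod n), g)) +
      Multiset.replicate (n - d - 1) ((1 : ZMod n), (0 : ZMod n × H))) := by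
    refine hG'.not_isZeroSumFree hp ?_
    simp only [Multiset.card_add, Multiset.card_map, Multiset.card_replicate, hScard]
    omega
  obtain ⟨U, hU, hU0, hsum⟩ := exists_zeroSum_of_not_isZeroSumFree hnot
  obtain ⟨V, hV, W, hW, rfl⟩ := Multiset.exists_add_of_le_add hU
  obtain ⟨T, hT, rfl⟩ := Multiset.exists_le_eq_map_of_le_map _ _ hV
  obtain ⟨j, hj, rfl⟩ := Multiset.le_replicate_iff.1 hW
  rw [Multiset.sum_add, sum_map_prodMk, Multiset.sum_replicate, Prod.ext_iff] at hsum
  simp only [Prod.smul_mk, nsmul_eq_mul, mul_one, smul_zero, Prod.mk_add_mk, add_zero,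
    Prod.fst_zero, Prod.snd_zero] at hsum
  obtain ⟨h1, h2⟩ := hsum
  rw [← Nat.cast_add, ZMod.natCast_eq_zero_iff] at h1
  have hT0 : T ≠ 0 := by
    rintro rfl
    simp only [Multiset.card_zero, zero_add] at h1
    have hj0 : j = 0 := Nat.eq_zero_of_dvd_of_lt h1 (by omega)
    simp [hj0] at hU0
  have hTcard := Multiset.card_le_card hT
  have hTn := hlong T hT hT0 h2
  rcases le_or_gt (Multiset.card T) (n + d) with hle | hgt
  · obtain ⟨c, hc⟩ := h1
    have : 1 < c := by
      by_contra! h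
      have := Nat.mul_le_mul_left n h
      omega
    have := Nat.mul_le_mul_left n this
    omega
  · obtain ⟨x, hx⟩ := Multiset.exists_mem_of_ne_zero hT0
    obtain ⟨T', rfl⟩ := Multiset.exists_cons_of_mem hx
    rw [Multiset.card_cons] at hgt hTcard h1
    obtain ⟨P, hP, hP0, hPsum⟩ := exists_zeroSum_of_not_isZeroSumFree
      (hG.not_isZeroSumFree hp (S := T') (by omega))
    have hPx : P ≤ x ::ₘ T' := hP.trans (Multiset.le_cons_self _ _)
    obtain ⟨Q, hQ⟩ := Multiset.le_iff_exists_add.1 hPx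
    have hQsum : Q.sum = 0 := by rw [hQ, Multiset.sum_add, hPsum, zero_add] at h2; exact h2
    have hQcard := congrArg Multiset.card hQ
    rw [Multiset.card_cons, Multiset.card_add] at hQcard
    have hPcard := Multiset.card_le_card hP
    have hQ0 : Q ≠ 0 := by
      rintro rfl
      rw [Multiset.card_zero] at hQcard
      omega
    have hPn := hlong P (hPx.trans hT) hP0 hPsum
    have hQn := hlong Q ((hQ ▸ Multiset.le_add_left Q P : Q ≤ x ::ₘ T').trans hT) hQ0 hQsum
    obtain ⟨c, hc⟩ := h1
    have : 2 < c := by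
      by_contra! h
      have := Nat.mul_le_mul_left n h
      omega
    have := Nat.mul_le_mul_left n this
    omega

/-! ### Passing from `ZMod n × H` to `ZMod (a * n) × H` -/

section Lift

variable {H : Type*} [AddCommGroup H]

/-- The projection `ZMod (a * n) × H → ZMod n × H`. -/
def zmodProdCast (a n : ℕ) (H : Type*) [AddCommGroup H] : ZMod (a * n) × H →+ ZMod n × H :=
  AddMonoidHom.prodMap (ZMod.castHom (dvd_mul_left n a) (ZMod n)).toAddMonoidHom
    (AddMonoidHom.id H)

theorem exists_eq_of_zmodProdCast_eq_zero {a n : ℕ} {x : ZMod (a * n) × H}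
    (hx : zmodProdCast a n H x = 0) : ∃ c : ℤ, x = (((n * c : ℤ) : ZMod (a * n)), 0) := by
  obtain ⟨u, h⟩ := x
  obtain ⟨z, rfl⟩ := ZMod.intCast_surjective u
  simp only [zmodProdCast, AddMonoidHom.prodMap_def, AddMonoidHom.prod_apply, Prod.ext_iff,
    AddMonoidHom.comp_apply, AddMonoidHom.coe_fst, AddMonoidHom.coe_snd, AddMonoidHom.id_apply,
    RingHom.toAddMonoidHom_eq_coe, AddMonoidHom.coe_coe, map_intCast, Prod.fst_zero,
    Prod.snd_zero, ZMod.intCast_zmod_eq_zero_iff_dvd] at hx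
  obtain ⟨⟨c, rfl⟩, rfl⟩ := hx
  exact ⟨c, rfl⟩

theorem exists_le_sum_sum_eq_zero_of_card_eq {a n : ℕ} (ha : 0 < a)
    (M : Multiset (Multiset (ZMod (a * n) × H))) (hM : Multiset.card M = a)
    (hblock : ∀ T ∈ M, T ≠ 0 ∧ zmodProdCast a n H T.sum = 0) :
    ∃ M' ≤ M, M'.sum ≠ 0 ∧ M'.sum.sum = 0 := by
  classical
  choose! c hc using fun x => exists_eq_of_zmodProdCast_eq_zero (a := a) (n := n) (H := H) (x := x)
  obtain ⟨t, ht, htcard, htsum⟩ := Int.erdos_ginzburg_ziv_multiset (n := a)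
    (M.map (fun T => c T.sum) + Multiset.replicate (a - 1) 0)
    (by rw [Multiset.card_add, Multiset.card_map, Multiset.card_replicate]; omega)
  obtain ⟨V, hV, W, hW, rfl⟩ := Multiset.exists_add_of_le_add ht
  obtain ⟨M', hM', rfl⟩ := Multiset.exists_le_eq_map_of_le_map _ _ hV
  obtain ⟨j, hj, rfl⟩ := Multiset.le_replicate_iff.1 hW
  rw [Multiset.card_add, Multiset.card_map, Multiset.card_replicate] at htcard
  rw [Multiset.sum_add, Multiset.sum_replicate, smul_zero, add_zero] at htsum
  have hblock' : ∀ T ∈ M', T ≠ 0 ∧ zmodProdCast a n H T.sum = 0 :=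
    fun T hT => hblock T (Multiset.mem_of_le hM' hT)
  have hsum : ∀ M : Multiset (Multiset (ZMod (a * n) × H)),
      (∀ T ∈ M, zmodProdCast a n H T.sum = 0) →
      M.sum.sum = (((n * (M.map fun T => c T.sum).sum : ℤ) : ZMod (a * n)), 0) := by
    intro M hM
    induction M using Multiset.induction_on with
    | empty => simp [Prod.ext_iff]
    | cons T M ih =>
      rw [Multiset.sum_cons, Multiset.sum_add, Multiset.map_cons, Multiset.sum_cons,
        ih fun T hT => hM T (Multiset.mem_cons_of_mem hT),
        hc T.sum (hM T (Multiset.mem_cons_self _ _)), Prod.mk_add_mk, add_zero, mul_add,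
        Int.cast_add, ← hc T.sum (hM T (Multiset.mem_cons_self _ _))]
  refine ⟨M', hM', ?_, ?_⟩
  · obtain ⟨T, hT⟩ := Multiset.exists_mem_of_ne_zero
      (Multiset.card_pos.1 (show 0 < Multiset.card M' by omega))
    obtain ⟨M'', rfl⟩ := Multiset.exists_cons_of_mem hT
    rw [Multiset.sum_cons]
    intro h
    exact (hblock' T hT).1 (add_eq_zero.1 h).1
  · rw [hsum M' fun T hT => (hblock' T hT).2, Prod.ext_iff]
    refine ⟨(ZMod.intCast_zmod_eq_zero_iff_dvd _ _).2 ?_, rfl⟩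
    rw [Nat.cast_mul, mul_comm]
    exact mul_dvd_mul_left _ htsum

theorem exists_le_zmodProdCast_sum_eq_zero {a n : ℕ} {P : ℕ → Prop}
    {S : Multiset (ZMod (a * n) × H)}
    (h : ∃ T ≤ S.map (zmodProdCast a n H), T ≠ 0 ∧ T.sum = 0 ∧ P (Multiset.card T)) :
    ∃ T ≤ S, T ≠ 0 ∧ zmodProdCast a n H T.sum = 0 ∧ P (Multiset.card T) := by
  obtain ⟨V, hV, hV0, hsum, hcard⟩ := h
  obtain ⟨T, hT, rfl⟩ := Multiset.exists_le_eq_map_of_le_map _ _ hV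
  refine ⟨T, hT, fun h => hV0 (by simp [h]), by rw [map_multiset_sum, hsum], by simpa using hcard⟩

theorem exists_blocks {a n s : ℕ}
    (hs : ∀ S : Multiset (ZMod n × H), n + s ≤ Multiset.card S →
      ∃ T ≤ S, T ≠ 0 ∧ T.sum = 0 ∧ Multiset.card T ≤ n) (j : ℕ)
    (S : Multiset (ZMod (a * n) × H)) (hS : j * n + s ≤ Multiset.card S) :
    ∃ M : Multiset (Multiset (ZMod (a * n) × H)), Multiset.card M = j ∧ M.sum ≤ S ∧
      ∀ T ∈ M, T ≠ 0 ∧ zmodProdCast a n H T.sum = 0 ∧ Multiset.card T ≤ n := by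
  induction j generalizing S with
  | zero => exact ⟨0, by simp, by simp, by simp⟩
  | succ j ih =>
    rw [Nat.succ_mul] at hS
    obtain ⟨T, hT, hT'⟩ := exists_le_zmodProdCast_sum_eq_zero (P := (· ≤ n))
      (hs (S.map (zmodProdCast a n H)) (by rw [Multiset.card_map]; omega))
    obtain ⟨R, rfl⟩ := Multiset.le_iff_exists_add.1 hT
    have := hT'.2.2
    rw [Multiset.card_add] at hS
    obtain ⟨M, hM, hMR, hblock⟩ := ih R (by omega)
    refine ⟨T ::ₘ M, by simp [hM], ?_, ?_⟩
    · rw [Multiset.sum_cons]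
      exact add_le_add le_rfl hMR
    · intro U hU
      rcases Multiset.mem_cons.1 hU with rfl | hU
      · exact hT'
      · exact hblock U hU

end Lift

section ProductInvariants

variable {p k d a : ℕ} {H : Type*} [AddCommGroup H]

theorem davenport_zmod_prod (hp : p.Prime) (hH : HasPrimePowerGenerators p H d)
    (hd : d + 1 ≤ p ^ k) {S : Multiset H} (hS : Multiset.card S = d) (hfree : IsZeroSumFree S)
    (ha : 0 < a) : davenport (ZMod (a * p ^ k) × H) = a * p ^ k + d := by
  have hn : 0 < p ^ k := pow_pos hp.pos k
  have hN : 0 < a * p ^ k := Nat.mul_pos ha hn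
  have hshort := exists_short_zeroSum hp hH hd
  have hG := hH.zmod_prod (k := k)
  generalize p ^ k = n at *
  rw [show a * n + d = (a * n - 1 + d) + 1 by omega]
  refine davenport_eq_of_isZeroSumFree (fun U hU hUfree => ?_) ?_ (hfree.replicate_add_map hN)
  · obtain ⟨b, rfl⟩ := Nat.exists_eq_add_one_of_ne_zero ha.ne'
    have hbn : (b + 1) * n = b * n + n := by ring
    obtain ⟨M, hM, hMU, hblock⟩ := exists_blocks (a := b + 1) hshort b U (by omega)
    obtain ⟨R, rfl⟩ := Multiset.le_iff_exists_add.1 hMU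
    have hMcard := Multiset.card_sum_le_of_forall_le fun T hT => (hblock T hT).2.2
    rw [Multiset.card_add] at hU
    rw [hM] at hMcard
    obtain ⟨T, hT, hT0, hTsum, -⟩ := exists_le_zmodProdCast_sum_eq_zero (P := fun _ => True)
      (S := R) (by
        obtain ⟨T, hT, hT0, hTsum⟩ := exists_zeroSum_of_not_isZeroSumFree
          (hG.not_isZeroSumFree hp (S := R.map (zmodProdCast (b + 1) n H))
            (by rw [Multiset.card_map]; omega))
        exact ⟨T, hT, hT0, hTsum, trivial⟩)
    obtain ⟨M', hM', hM0, hsum⟩ := exists_le_sum_sum_eq_zero_of_card_eq ha (T ::ₘ M)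
      (by rw [Multiset.card_cons, hM]) (by
        intro V hV
        rcases Multiset.mem_cons.1 hV with rfl | hV
        · exact ⟨hT0, hTsum⟩
        · exact ⟨(hblock V hV).1, (hblock V hV).2.1⟩)
    refine hM0 (hUfree _ ((Multiset.sum_le_sum_of_le hM').trans ?_) hsum)
    rw [Multiset.sum_cons, add_comm T]
    exact add_le_add le_rfl hT
  · simp [hS]

theorem etaInv_zmod_prod (hp : p.Prime) (hH : HasPrimePowerGenerators p H d)
    (hd : d + 1 ≤ p ^ k) {S : Multiset H} (hS : Multiset.card S = d) (hfree : IsZeroSumFree S)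
    (ha : 0 < a) (hexp : AddMonoid.exponent (ZMod (a * p ^ k) × H) = a * p ^ k) :
    etaInv (ZMod (a * p ^ k) × H) = a * p ^ k + 2 * d := by
  have hN : 0 < a * p ^ k := Nat.mul_pos ha (pow_pos hp.pos k)
  refine zsInv_eq_of_card_add_one (fun U hU => ?_) (S :=
    Multiset.replicate (a * p ^ k - 1) (1, 0) + ((S.map fun h => (0, h)) + S.map fun h => (1, h)))
    ?_ fun T hT hsum hcard => ?_
  · obtain ⟨M, hM, hMU, hblock⟩ := exists_blocks (exists_short_zeroSum hp hH hd) a U hU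
    obtain ⟨M', hM', hM0, hsum⟩ := exists_le_sum_sum_eq_zero_of_card_eq ha M hM
      fun T hT => ⟨(hblock T hT).1, (hblock T hT).2.1⟩
    refine ⟨M'.sum, (Multiset.sum_le_sum_of_le hM').trans hMU, hM0, hsum,
      Multiset.card_pos.2 hM0, ?_⟩
    rw [hexp]
    refine (Multiset.card_sum_le_of_forall_le fun T hT =>
      (hblock T (Multiset.mem_of_le hM' hT)).2.2).trans ?_
    exact Nat.mul_le_mul_right _ ((Multiset.card_le_card hM').trans_eq hM)
  · simp only [Multiset.card_add, Multiset.card_replicate, Multiset.card_map, hS]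
    omega
  · exact hfree.eq_zero_of_card_le hN hT hsum (hcard.2.trans_eq hexp)

end ProductInvariants

theorem exists_eq_prime_pow_of_addEquiv_pi {p : ℕ} (hp : p.Prime) {H : Type*} [AddCommGroup H]
    (hpH : ∀ h : H, ∃ k : ℕ, p ^ k • h = 0) {r : ℕ} {m : Fin r → ℕ}
    (φ : H ≃+ ((i : Fin r) → ZMod (m i))) (i : Fin r) : ∃ q, m i = p ^ q := by
  obtain ⟨k, hk⟩ := hpH (φ.symm (Pi.single i 1))
  rw [← map_nsmul, EmbeddingLike.map_eq_zero_iff] at hk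
  have h := congrFun hk i
  rw [Pi.smul_apply, Pi.single_eq_same, nsmul_one, Pi.zero_apply, ZMod.natCast_eq_zero_iff] at h
  obtain ⟨q, -, hq⟩ := (Nat.dvd_prime_pow hp).1 h
  exact ⟨q, hq⟩

theorem HasPrimePowerGenerators.of_addEquiv_pi {p : ℕ} {H : Type*} [AddCommGroup H]
    {r : ℕ} {q : Fin r → ℕ} (φ : H ≃+ ((i : Fin r) → ZMod (p ^ q i))) :
    HasPrimePowerGenerators p H (∑ i, (p ^ q i - 1)) := by
  refine ⟨Fin r, inferInstance, fun i => φ.symm (Pi.single i 1), q, fun i => ?_, ?_, rfl⟩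
  · rw [← map_nsmul, ← Pi.single_smul, nsmul_one, ZMod.natCast_self, Pi.single_zero, map_zero]
  · refine eq_top_iff.2 fun h _ => ?_
    obtain ⟨x, rfl⟩ := φ.symm.surjective h
    rw [← Finset.univ_sum_single x, map_sum]
    refine AddSubgroup.sum_mem _ fun i _ => ?_
    obtain ⟨z, hz⟩ := ZMod.intCast_surjective (x i)
    have : (Pi.single i (x i) : (i : Fin r) → ZMod (p ^ q i)) = z • Pi.single i 1 := by
      rw [← Pi.single_smul, ← hz, zsmul_one]
    rw [this, map_zsmul]
    exact AddSubgroup.zsmul_mem _ (AddSubgroup.subset_closure (Set.mem_range_self i)) z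

theorem exponent_zmod_mul_prod {a n : ℕ} {H : Type*} [AddCommGroup H]
    (hexp : AddMonoid.exponent (ZMod n × H) = n) :
    AddMonoid.exponent (ZMod (a * n) × H) = a * n := by
  rw [AddMonoid.exponent_prod, ZMod.exponent] at hexp ⊢
  exact Nat.dvd_antisymm
    (Nat.lcm_dvd dvd_rfl ((hexp ▸ Nat.dvd_lcm_right _ _ : _ ∣ n).trans (dvd_mul_left n a)))
    (Nat.dvd_lcm_left _ _)

/-- Write a finite abelian `p`-group `G` with `exp(G) = n` and
`D(G) ≤ 2n − 1` as `G = C_n ⊕ H`, and for a positive integer `a` let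
`G' = C_{a·n} ⊕ H`. If `p > 2·r(H)` and `⌈2·D(H)/exp(H)⌉` is either even or at most `3`,
then `2·D(G') − 1 = η(G') + exp(G') − 1`. -/
theorem stmt19 (p : ℕ) (hp : p.Prime) (n : ℕ) (hn : ∃ k : ℕ, n = p ^ k)
    (H : Type*) [AddCommGroup H] [Finite H]
    (hpH : ∀ h : H, ∃ k : ℕ, p ^ k • h = 0)
    (hexp : AddMonoid.exponent (ZMod n × H) = n)
    (hD : davenport (ZMod n × H) ≤ 2 * n - 1)
    (r : ℕ) (m : Fin r → ℕ) (hm : ∀ i, 1 < m i)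
    (hdvd : ∀ i j : Fin r, i ≤ j → m i ∣ m j)
    (hiso : Nonempty (H ≃+ ((i : Fin r) → ZMod (m i))))
    (hpr : 2 * r < p)
    (hceil : Even ((2 * davenport H + AddMonoid.exponent H - 1) / AddMonoid.exponent H) ∨
      (2 * davenport H + AddMonoid.exponent H - 1) / AddMonoid.exponent H ≤ 3)
    (a : ℕ) (ha : 0 < a) :
    2 * davenport (ZMod (a * n) × H) - 1 =
      etaInv (ZMod (a * n) × H) + AddMonoid.exponent (ZMod (a * n) × H) - 1 := by
  obtain ⟨k, rfl⟩ := hn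
  obtain ⟨φ⟩ := hiso
  choose q hq using exists_eq_prime_pow_of_addEquiv_pi hp hpH φ
  obtain rfl : m = fun i => p ^ q i := funext hq
  have hH := HasPrimePowerGenerators.of_addEquiv_pi φ
  have hfree := (isZeroSumFree_sum_replicate_single hm).map_addEquiv φ.symm
  set S := (∑ i, Multiset.replicate (p ^ q i - 1)
    (Pi.single i 1 : (i : Fin r) → ZMod (p ^ q i))).map φ.symm
  have hS : Multiset.card S = ∑ i, (p ^ q i - 1) := by simp [S]
  generalize ∑ i, (p ^ q i - 1) = d at hH hS
  have hn0 : 0 < p ^ k := pow_pos hp.pos k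
  have hd : d + 1 ≤ p ^ k := by
    have hle : p ^ k - 1 + d + 1 ≤ davenport (ZMod (p ^ k) × H) := by
      rw [davenport_eq_of_isZeroSumFree (d := p ^ k - 1 + d)
        (fun U hU => hH.zmod_prod.not_isZeroSumFree hp hU) ?_ (hfree.replicate_add_map hn0)]
      simp [hS]
    omega
  have hexp' := exponent_zmod_mul_prod (a := a) hexp
  rw [davenport_zmod_prod hp hH hd hS hfree ha, etaInv_zmod_prod hp hH hd hS hfree ha hexp', hexp']
  omega
end
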